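/- arXiv:1208.3267 — 2 statements merged into one kernel-verified Lean document; each statement's English description precedes it below -/
import Mathlib

section
/- Let (D_{j,N})_{j=1}^N be a partition of S^d into N sets of equal measure 1/N with diam D_{j,N} ≤ c·N^{−1/d}, and suppose d/2 < s < d/2+1. If x_j is chosen uniformly at random from D_{j,N} (independently), then E[ {wce(Q[X_N]; H^s)}² ] = (1/N²) Σ_{j=1}^N ∫∫_{D_{j,N}×D_{j,N}} |x−y|^{2s−d} dμ_j(x) dμ_j(y) ≤ c^{2s−d} N^{−2s/d}, where μ_j = N·σ_d|_{D_{j,N}}. -/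
open MeasureTheory
open scoped ENNReal

lemma aux_integral_sigma {X : Type*} [MeasurableSpace X] (σ : Measure X) [IsProbabilityMeasure σ]
    (N : ℕ) (hN : 0 < N) (D : Fin N → Set X) (hDmeas : ∀ j, MeasurableSet (D j))
    (hDdisj : Pairwise (Function.onFun Disjoint D)) (hDcover : (⋃ j, D j) = Set.univ)
    (f : X → ℝ) (hf : Integrable f σ) :
    ∫ u, f u ∂σ = (1 / (N : ℝ)) * ∑ j, ∫ u, f u ∂((N : ℝ≥0∞) • σ.restrict (D j)) := by
  have h : ∫ u, f u ∂σ = ∑ j, ∫ u in D j, f u ∂σ := by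
    rw [← integral_iUnion_fintype hDmeas hDdisj (fun i => hf.integrableOn), hDcover,
      Measure.restrict_univ]
  have hN' : (N : ℝ) ≠ 0 := by positivity
  simp only [integral_smul_measure, ENNReal.toReal_natCast, smul_eq_mul]
  rw [h, ← Finset.mul_sum]
  field_simp

lemma aux_pi_pair {X : Type*} [MeasurableSpace X] (N : ℕ) (μ : Fin N → Measure X)
    [∀ j, IsProbabilityMeasure (μ j)] (k : X → X → ℝ)
    (hk : Measurable (Function.uncurry k)) (C : ℝ) (hC : ∀ u v, ‖k u v‖ ≤ C)
    (i j : Fin N) (hij : i ≠ j) :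
    ∫ x : Fin N → X, k (x i) (x j) ∂(Measure.pi μ) = ∫ u, ∫ v, k u v ∂(μ j) ∂(μ i) := by
  have hind : ProbabilityTheory.iIndepFun (fun (i : Fin N) (x : Fin N → X) => x i)
      (Measure.pi μ) :=
    ProbabilityTheory.iIndepFun_pi (X := fun _ => id) (fun _ => aemeasurable_id)
  have h2 := hind.indepFun hij
  rw [ProbabilityTheory.indepFun_iff_map_prod_eq_prod_map_map
    (measurable_pi_apply i).aemeasurable (measurable_pi_apply j).aemeasurable] at h2
  have e : ∀ i, Measure.map (fun x : Fin N → X => x i) (Measure.pi μ) = μ i := fun i =>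
    (measurePreserving_eval μ i).map_eq
  rw [e, e] at h2
  have hint : Integrable (Function.uncurry k) ((μ i).prod (μ j)) :=
    Integrable.of_bound hk.aestronglyMeasurable C (by filter_upwards with x using hC _ _)
  have h3 := integral_prod _ hint
  rw [← h2, integral_map (by fun_prop) hk.aestronglyMeasurable] at h3
  exact h3

lemma aux_expect {X : Type*} [MeasurableSpace X] (σ : Measure X) [IsProbabilityMeasure σ]
    (N : ℕ) (hN : 0 < N) (D : Fin N → Set X) (hDmeas : ∀ j, MeasurableSet (D j))
    (hDdisj : Pairwise (Function.onFun Disjoint D)) (hDcover : (⋃ j, D j) = Set.univ)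
    [∀ j, IsProbabilityMeasure ((N : ℝ≥0∞) • σ.restrict (D j))]
    (k : X → X → ℝ) (hk : Measurable (Function.uncurry k)) (C : ℝ) (hC : ∀ u v, ‖k u v‖ ≤ C)
    (hk0 : ∀ u, k u u = 0) :
    ∫ x : Fin N → X, ((∫ u, ∫ v, k u v ∂σ ∂σ) - (1 / (N : ℝ) ^ 2) * ∑ j, ∑ i, k (x j) (x i))
      ∂(Measure.pi fun j => (N : ℝ≥0∞) • σ.restrict (D j))
    = (1 / (N : ℝ) ^ 2) * ∑ j, ∫ u, ∫ v, k u v ∂((N : ℝ≥0∞) • σ.restrict (D j))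
        ∂((N : ℝ≥0∞) • σ.restrict (D j)) := by
  set μ : Fin N → Measure X := fun j => (N : ℝ≥0∞) • σ.restrict (D j) with hμ
  have hi1 : ∀ (ν : Measure X) [IsProbabilityMeasure ν] (u : X), Integrable (k u) ν := by
    intro ν _ u
    exact Integrable.of_bound (hk.comp measurable_prodMk_left).aestronglyMeasurable C
      (by filter_upwards with x using hC _ _)
  have hi2 : ∀ (ν ρ : Measure X) [IsProbabilityMeasure ν] [IsProbabilityMeasure ρ],
      Integrable (fun u => ∫ v, k u v ∂ν) ρ := by
    intro ν ρ _ _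
    have hint : Integrable (Function.uncurry k) (ρ.prod ν) :=
      Integrable.of_bound hk.aestronglyMeasurable C (by filter_upwards with x using hC _ _)
    exact hint.integral_prod_left
  have hV : ∫ u, ∫ v, k u v ∂σ ∂σ
      = (1 / (N : ℝ) ^ 2) * ∑ j, ∑ i, ∫ u, ∫ v, k u v ∂(μ i) ∂(μ j) := by
    rw [aux_integral_sigma σ N hN D hDmeas hDdisj hDcover _ (hi2 σ σ)]
    have : ∀ u, ∫ v, k u v ∂σ = (1 / (N : ℝ)) * ∑ i, ∫ v, k u v ∂(μ i) := fun u =>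
      aux_integral_sigma σ N hN D hDmeas hDdisj hDcover _ (hi1 σ u)
    have h2 : ∀ j, ∫ u, ∫ v, k u v ∂σ ∂(μ j)
        = (1 / (N : ℝ)) * ∑ i, ∫ u, ∫ v, k u v ∂(μ i) ∂(μ j) := by
      intro j
      simp_rw [this]
      rw [integral_const_mul, integral_finsetSum]
      intro i _
      exact hi2 (μ i) (μ j)
    change (1 / (N : ℝ)) * ∑ j, ∫ u, ∫ v, k u v ∂σ ∂(μ j) = _
    simp_rw [h2]
    rw [← Finset.mul_sum]
    ring
  have hip : ∀ i j, Integrable (fun x : Fin N → X => k (x j) (x i)) (Measure.pi μ) := by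
    intro i j
    refine Integrable.of_bound (Measurable.aestronglyMeasurable ?_) C
      (by filter_upwards with x using hC _ _)
    have hm : Measurable (fun x : Fin N → X => (x j, x i)) :=
      (measurable_pi_apply j).prodMk (measurable_pi_apply i)
    exact hk.comp hm
  rw [integral_sub (integrable_const _)
    ((integrable_finsetSum _ fun j _ => integrable_finsetSum _ fun i _ => hip i j).const_mul _),
    integral_const_mul, integral_finsetSum _
      (fun j _ => integrable_finsetSum _ fun i _ => hip i j)]
  have h4 : ∀ j, ∫ x : Fin N → X, ∑ i, k (x j) (x i) ∂(Measure.pi μ)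
      = ∑ i, ∫ u, ∫ v, k u v ∂(μ i) ∂(μ j) - ∫ u, ∫ v, k u v ∂(μ j) ∂(μ j) := by
    intro j
    rw [integral_finsetSum _ (fun i _ => hip i j),
      ← Finset.add_sum_erase _ _ (Finset.mem_univ j),
      ← Finset.add_sum_erase _ (fun i => ∫ u, ∫ v, k u v ∂(μ i) ∂(μ j)) (Finset.mem_univ j)]
    simp only [hk0, integral_zero, zero_add, add_sub_cancel_left]
    refine Finset.sum_congr rfl fun i hi => ?_
    exact aux_pi_pair N μ k hk C hC j i (Finset.ne_of_mem_erase hi).symm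
  simp_rw [h4]
  rw [Finset.sum_sub_distrib, hV]
  simp only [integral_const, probReal_univ, smul_eq_mul, one_mul]
  ring

/-- Randomized equal-area points: let `D_1,…,D_N` be a partition of `S^d` into `N` sets of
measure `1/N` each with `diam D_j ≤ c·N^{-1/d}`, and let `x_j` be chosen independently and
uniformly from `D_j` (law `μ_j = N·σ|_{D_j}`).  For `d/2 < s < d/2+1`, the expected squared
worst-case error `E[V_{d-2s} − (1/N²)∑_{j,i}|x_j−x_i|^{2s−d}]` (where
`V_{d-2s} = ∫∫ |x−y|^{2s−d} dσ dσ`) equals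
`(1/N²)∑_j ∫∫_{D_j×D_j} |x−y|^{2s−d} dμ_j dμ_j` and is at most `c^{2s−d}·N^{-2s/d}`. -/
theorem randomized_equal_area_expected_wce (d : ℕ) (hd : 1 ≤ d) (s c : ℝ)
    (hs1 : (d : ℝ) / 2 < s) (hs2 : s < (d : ℝ) / 2 + 1) (hc : 0 < c)
    (σ : Measure (Metric.sphere (0 : EuclideanSpace ℝ (Fin (d + 1))) 1))
    [IsProbabilityMeasure σ]
    (N : ℕ) (hN : 0 < N)
    (D : Fin N → Set (Metric.sphere (0 : EuclideanSpace ℝ (Fin (d + 1))) 1))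
    (hDmeas : ∀ j, MeasurableSet (D j))
    (hDdisj : Pairwise (Function.onFun Disjoint D))
    (hDcover : (⋃ j, D j) = Set.univ)
    (hDarea : ∀ j, σ (D j) = 1 / N)
    (hDdiam : ∀ j, Metric.diam (D j) ≤ c * (N : ℝ) ^ (-(1 : ℝ) / d)) :
    (∫ x : Fin N → Metric.sphere (0 : EuclideanSpace ℝ (Fin (d + 1))) 1,
        ((∫ u, ∫ v, ‖(u : EuclideanSpace ℝ (Fin (d + 1))) - v‖ ^ (2 * s - d) ∂σ ∂σ)
          - (1 / (N : ℝ) ^ 2) *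
              ∑ j, ∑ i, ‖(x j : EuclideanSpace ℝ (Fin (d + 1))) - (x i : EuclideanSpace ℝ (Fin (d + 1)))‖ ^ (2 * s - d))
        ∂(Measure.pi fun j => (N : ℝ≥0∞) • σ.restrict (D j)))
      = (1 / (N : ℝ) ^ 2) *
          ∑ j, ∫ u, ∫ v, ‖(u : EuclideanSpace ℝ (Fin (d + 1))) - v‖ ^ (2 * s - d)
            ∂((N : ℝ≥0∞) • σ.restrict (D j)) ∂((N : ℝ≥0∞) • σ.restrict (D j)) ∧
    (∫ x : Fin N → Metric.sphere (0 : EuclideanSpace ℝ (Fin (d + 1))) 1,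
        ((∫ u, ∫ v, ‖(u : EuclideanSpace ℝ (Fin (d + 1))) - v‖ ^ (2 * s - d) ∂σ ∂σ)
          - (1 / (N : ℝ) ^ 2) *
              ∑ j, ∑ i, ‖(x j : EuclideanSpace ℝ (Fin (d + 1))) - (x i : EuclideanSpace ℝ (Fin (d + 1)))‖ ^ (2 * s - d))
        ∂(Measure.pi fun j => (N : ℝ≥0∞) • σ.restrict (D j)))
      ≤ c ^ (2 * s - d) * (N : ℝ) ^ (-(2 * s) / d) := by
  have hp : 0 < 2 * s - d := by linarith
  have hNr : (0 : ℝ) < N := by exact_mod_cast hN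
  have hprob : ∀ j, IsProbabilityMeasure ((N : ℝ≥0∞) • σ.restrict (D j)) := by
    intro j
    constructor
    simp only [Measure.smul_apply, Measure.restrict_apply_univ, smul_eq_mul, hDarea]
    rw [one_div]
    exact ENNReal.mul_inv_cancel (by exact_mod_cast hN.ne') (ENNReal.natCast_ne_top N)
  have hcont : Continuous (Function.uncurry
      fun u v : Metric.sphere (0 : EuclideanSpace ℝ (Fin (d + 1))) 1 =>
      ‖(u : EuclideanSpace ℝ (Fin (d + 1))) - v‖ ^ (2 * s - d)) := by
    unfold Function.uncurry
    exact Continuous.rpow_const (by fun_prop) (fun _ => Or.inr hp.le)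
  have hbd : ∀ u v : Metric.sphere (0 : EuclideanSpace ℝ (Fin (d + 1))) 1,
      ‖‖(u : EuclideanSpace ℝ (Fin (d + 1))) - v‖ ^ (2 * s - d)‖ ≤ (2 : ℝ) ^ (2 * s - d) := by
    intro u v
    rw [Real.norm_of_nonneg (by positivity)]
    refine Real.rpow_le_rpow (norm_nonneg _) ?_ hp.le
    refine (norm_sub_le _ _).trans ?_
    rw [norm_eq_of_mem_sphere, norm_eq_of_mem_sphere]
    norm_num
  have key := aux_expect σ N hN D hDmeas hDdisj hDcover
    (fun u v => ‖(u : EuclideanSpace ℝ (Fin (d + 1))) - v‖ ^ (2 * s - d)) hcont.measurable _ hbd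
    (fun u => by simp [Real.zero_rpow hp.ne'])
  refine ⟨key, key.trans_le ?_⟩
  have hae : ∀ j, ∀ᵐ u ∂((N : ℝ≥0∞) • σ.restrict (D j)), u ∈ D j := fun j =>
    Measure.ae_smul_measure (ae_restrict_mem (hDmeas j)) _
  set B : ℝ := (c * (N : ℝ) ^ (-(1 : ℝ) / d)) ^ (2 * s - d) with hB
  have hB0 : 0 ≤ B := by positivity
  have hbound : ∀ j, ∫ u, ∫ v, ‖(u : EuclideanSpace ℝ (Fin (d + 1))) - v‖ ^ (2 * s - d)
            ∂((N : ℝ≥0∞) • σ.restrict (D j)) ∂((N : ℝ≥0∞) • σ.restrict (D j)) ≤ B := by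
    intro j
    have hle : ∀ {ν : Measure (Metric.sphere (0 : EuclideanSpace ℝ (Fin (d + 1))) 1)}
        [IsProbabilityMeasure ν] {f : _ → ℝ}, (∀ᵐ u ∂ν, ‖f u‖ ≤ B) → ‖∫ u, f u ∂ν‖ ≤ B := by
      intro ν _ f hf
      simpa using norm_integral_le_of_norm_le_const hf
    refine (le_abs_self _).trans (hle ?_)
    filter_upwards [hae j] with u hu
    refine hle ?_
    filter_upwards [hae j] with v hv
    rw [Real.norm_of_nonneg (by positivity)]
    refine Real.rpow_le_rpow (norm_nonneg _) ?_ hp.le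
    rw [← dist_eq_norm]
    exact (Metric.dist_le_diam_of_mem (Metric.isBounded_of_compactSpace) hu hv).trans (hDdiam j)
  calc _ ≤ (1 / (N : ℝ) ^ 2) * ∑ j : Fin N, B := by
        gcongr with j _
        exact hbound j
    _ = (N : ℝ) ^ (-1 : ℝ) * B := by
        rw [Real.rpow_neg_one]
        simp
        field_simp
    _ = c ^ (2 * s - d) * (N : ℝ) ^ (-(2 * s) / d) := by
        have hd0 : (d : ℝ) ≠ 0 := by positivity
        rw [hB, Real.mul_rpow hc.le (by positivity), ← Real.rpow_mul hNr.le, mul_left_comm,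
          ← Real.rpow_add hNr]
        congr 2
        field_simp
        ring
end

section
/- For d/2 < s < d/2 + 1 and any N-point configuration X_N = {x_1,…,x_N} ⊂ S^d, the quantity V_{d−2s}(S^d) − (1/N²) Σ_{j=1}^N Σ_{i=1}^N |x_j − x_i|^{2s−d} is nonnegative, where V_{d−2s}(S^d) = ∫_{S^d}∫_{S^d} |x−y|^{2s−d} dσ_d(x) dσ_d(y). -/
open MeasureTheory

/-- The normalized uniform (surface) probability measure on the unit sphere
`S^d ⊂ ℝ^{d+1}`. -/
noncomputable def uniformSphereMeasure (d : ℕ) :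
    Measure (Metric.sphere (0 : EuclideanSpace ℝ (Fin (d + 1))) 1) :=
  ((volume : Measure (EuclideanSpace ℝ (Fin (d + 1)))).toSphere Set.univ)⁻¹ •
    (volume : Measure (EuclideanSpace ℝ (Fin (d + 1)))).toSphere

open scoped Pointwise

lemma choose_succ_rec (a : ℝ) (k : ℕ) :
    ((k : ℝ) + 1) * Ring.choose a (k + 1) = (a - k) * Ring.choose a k := by
  have h1 := Ring.descPochhammer_eq_factorial_smul_choose a (k + 1)
  have h2 := Ring.descPochhammer_eq_factorial_smul_choose a k
  rw [descPochhammer_succ_right, Polynomial.smeval_mul, h2] at h1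
  simp [Polynomial.smeval_natCast, Nat.factorial_succ] at h1
  have h3 : (k.factorial : ℝ) ≠ 0 := by exact_mod_cast k.factorial_ne_zero
  apply mul_left_cancel₀ h3
  linarith

lemma coeff_nonpos {a : ℝ} (h0 : 0 < a) (h1 : a < 1) (k : ℕ) :
    (-1) ^ (k + 1) * Ring.choose a (k + 1) ≤ 0 := by
  induction k with
  | zero => simp [Ring.choose_one_right]; linarith
  | succ k ih =>
    have h := choose_succ_rec a (k + 1)
    have hk : (0 : ℝ) < ((k + 1 : ℕ) : ℝ) + 1 := by positivity
    have h2 : (((k + 1 : ℕ) : ℝ) + 1) * ((-1) ^ (k + 1 + 1) * Ring.choose a (k + 1 + 1)) =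
        (((k + 1 : ℕ) : ℝ) - a) * ((-1) ^ (k + 1) * Ring.choose a (k + 1)) := by
      rw [pow_succ (-1 : ℝ) (k + 1)]
      linear_combination (-1) ^ (k + 1) * (-1) * h
    have h3 : (((k + 1 : ℕ) : ℝ) + 1) * ((-1) ^ (k + 1 + 1) * Ring.choose a (k + 1 + 1)) ≤ 0 := by
      rw [h2]
      apply mul_nonpos_of_nonneg_of_nonpos _ ih
      push_cast
      have : (0 : ℝ) ≤ k := by positivity
      linarith
    by_contra hc
    push Not at hc
    nlinarith [mul_pos hk hc]

lemma hasSum_one_sub_rpow (a : ℝ) {t : ℝ} (ht : |t| < 1) :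
    HasSum (fun k : ℕ => (-1) ^ k * Ring.choose a k * t ^ k) ((1 - t) ^ a) := by
  have h := (Real.one_add_rpow_hasFPowerSeriesOnBall_zero (a := a)).hasSum (y := -t)
    (by simpa [enorm_eq_nnnorm, ← NNReal.coe_lt_coe] using ht)
  simp only [binomialSeries_apply] at h
  convert! h using 1
  · ext k
    simp [List.ofFn_const, List.prod_replicate]
    rw [neg_pow t k]; ring
  · simp [sub_eq_add_neg]

lemma hasSum_integral_aux {Ω : Type*} [MeasurableSpace Ω] (μ : Measure Ω) [IsProbabilityMeasure μ]
    (f : Ω → ℝ) (hf : Measurable f) (hf1 : ∀ ω, |f ω| ≤ 1) (a r : ℝ) (hr0 : 0 < r) (hr1 : r < 1) :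
    HasSum (fun k : ℕ => (-1) ^ k * Ring.choose a k * r ^ k * ∫ ω, f ω ^ k ∂μ)
      (∫ ω, (1 - r * f ω) ^ a ∂μ) := by
  have hb : ∀ (k : ℕ) ω, ‖(-1) ^ k * Ring.choose a k * (r * f ω) ^ k‖ ≤ 
      ‖(-1) ^ k * Ring.choose a k * r ^ k‖ := by
    intro k ω
    rw [mul_pow, ← mul_assoc, norm_mul _ (f ω ^ k)]
    have : ‖f ω ^ k‖ ≤ 1 := by
      rw [norm_pow]; exact pow_le_one₀ (norm_nonneg _) (hf1 ω)
    exact mul_le_of_le_one_right (norm_nonneg _) this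
  have hint : ∀ k : ℕ, Integrable (fun ω => (-1) ^ k * Ring.choose a k * (r * f ω) ^ k) μ := by
    intro k
    refine Integrable.of_bound (C := ‖(-1) ^ k * Ring.choose a k * r ^ k‖) ?_ ?_
    · exact Measurable.aestronglyMeasurable (by fun_prop)
    · exact Filter.Eventually.of_forall (hb k)
  have hsum : Summable (fun k : ℕ => ‖(-1) ^ k * Ring.choose a k * r ^ k‖) := by
    have := (hasSum_one_sub_rpow a (t := r) (by rw [abs_of_pos hr0]; exact hr1)).summable
    exact this.norm
  have key := hasSum_integral_of_summable_integral_norm hint (by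
    refine Summable.of_nonneg_of_le (fun k => integral_nonneg fun ω => norm_nonneg _) (fun k => ?_) hsum
    calc ∫ ω, ‖(-1) ^ k * Ring.choose a k * (r * f ω) ^ k‖ ∂μ 
        ≤ ∫ ω, ‖(-1) ^ k * Ring.choose a k * r ^ k‖ ∂μ :=
          integral_mono (hint k).norm (integrable_const _) (hb k)
      _ = _ := by simp)
  convert! key using 1
  · ext k
    rw [← integral_const_mul]
    congr 1; ext ω; rw [mul_pow]; ring
  · congr 1; ext ω
    refine (hasSum_one_sub_rpow a ?_).tsum_eq.symm
    rw [abs_mul, abs_of_pos hr0]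
    have := hf1 ω
    nlinarith [abs_nonneg (f ω)]

lemma tendsto_aux {Ω : Type*} [MeasurableSpace Ω] (μ : Measure Ω) [IsProbabilityMeasure μ]
    (f : Ω → ℝ) (hf : Measurable f) (hf1 : ∀ ω, |f ω| ≤ 1) (a : ℝ) (ha : 0 < a) :
    Filter.Tendsto (fun n : ℕ => ∫ ω, (1 - (1 - 1 / ((n : ℝ) + 2)) * f ω) ^ a ∂μ) Filter.atTop
      (nhds (∫ ω, (1 - f ω) ^ a ∂μ)) := by
  have hr : ∀ n : ℕ, 0 < 1 - 1 / ((n : ℝ) + 2) ∧ 1 - 1 / ((n : ℝ) + 2) < 1 := by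
    intro n
    have hn : (0 : ℝ) ≤ n := by positivity
    have h2 : 1 / ((n : ℝ) + 2) < 1 := by rw [div_lt_one (by positivity)]; linarith
    have h3 : 0 < 1 / ((n : ℝ) + 2) := by positivity
    constructor <;> linarith
  refine tendsto_integral_of_dominated_convergence (fun _ => (2 : ℝ) ^ a) ?_ (integrable_const _) ?_ ?_
  · intro n
    exact Measurable.aestronglyMeasurable (by fun_prop)
  · intro n
    refine Filter.Eventually.of_forall fun ω => ?_
    obtain ⟨h1, h2⟩ := hr n
    have h3 : |(1 - 1 / ((n : ℝ) + 2)) * f ω| ≤ 1 := by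
      rw [abs_mul, abs_of_pos h1]
      nlinarith [abs_nonneg (f ω), hf1 ω]
    have h4 := abs_le.1 h3
    rw [Real.norm_of_nonneg (Real.rpow_nonneg (by linarith) _)]
    exact Real.rpow_le_rpow (by linarith) (by linarith) ha.le
  · refine Filter.Eventually.of_forall fun ω => ?_
    have h0 : Filter.Tendsto (fun n : ℕ => 1 / ((n : ℝ) + 2)) Filter.atTop (nhds 0) := by
      have := (tendsto_one_div_add_atTop_nhds_zero_nat (𝕜 := ℝ)).comp (Filter.tendsto_add_atTop_nat 1)
      refine this.congr fun n => ?_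
      simp only [Function.comp]; push_cast; ring
    have h1 : Filter.Tendsto (fun n : ℕ => 1 - (1 - 1 / ((n : ℝ) + 2)) * f ω) Filter.atTop
        (nhds (1 - (1 - 0) * f ω)) := ((h0.const_sub 1).mul_const _).const_sub 1
    have := h1.rpow_const (p := a) (Or.inr ha.le)
    simpa using this

/-- Moment comparison implies comparison of `(1-t)^a` integrals. -/
lemma moment_comparison {Ω Ω' : Type*} [MeasurableSpace Ω] [MeasurableSpace Ω']
    (μ : Measure Ω) [IsProbabilityMeasure μ] (ν : Measure Ω') [IsProbabilityMeasure ν]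
    (f : Ω → ℝ) (hf : Measurable f) (hf1 : ∀ ω, |f ω| ≤ 1)
    (g : Ω' → ℝ) (hg : Measurable g) (hg1 : ∀ ω, |g ω| ≤ 1)
    (hm : ∀ k : ℕ, ∫ ω, g ω ^ k ∂ν ≤ ∫ ω, f ω ^ k ∂μ)
    (a : ℝ) (h0 : 0 < a) (h1 : a < 1) :
    ∫ ω, (1 - f ω) ^ a ∂μ ≤ ∫ ω, (1 - g ω) ^ a ∂ν := by
  refine le_of_tendsto_of_tendsto' (tendsto_aux μ f hf hf1 a h0) (tendsto_aux ν g hg hg1 a h0) ?_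
  intro n
  have hn : (0 : ℝ) ≤ n := by positivity
  have h2 : 1 / ((n : ℝ) + 2) < 1 := by rw [div_lt_one (by positivity)]; linarith
  have h3 : 0 < 1 / ((n : ℝ) + 2) := by positivity
  set r := 1 - 1 / ((n : ℝ) + 2)
  have hr0 : 0 < r := by simp only [r]; linarith
  have hr1 : r < 1 := by simp only [r]; linarith
  refine hasSum_le ?_ (hasSum_integral_aux μ f hf hf1 a r hr0 hr1)
    (hasSum_integral_aux ν g hg hg1 a r hr0 hr1)
  intro k
  cases k with
  | zero => simp
  | succ k =>
    refine mul_le_mul_of_nonpos_left (hm _) ?_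
    exact mul_nonpos_of_nonpos_of_nonneg (coeff_nonpos h0 h1 k) (by positivity)

section sph
variable {d : ℕ}

local notation "EE" => EuclideanSpace ℝ (Fin (d + 1))
local notation "SS" => Metric.sphere (0 : EuclideanSpace ℝ (Fin (d + 1))) 1

instance instProbUniformSphere : IsProbabilityMeasure (uniformSphereMeasure d) := by
  constructor
  rw [uniformSphereMeasure, Measure.smul_apply, smul_eq_mul]
  refine ENNReal.inv_mul_cancel ?_ (measure_ne_top _ _)
  rw [Ne, Measure.measure_univ_eq_zero]
  exact Measure.toSphere_ne_zero _

noncomputable def sphMap (R : EE ≃ₗᵢ[ℝ] EE) (v : SS) : SS :=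
  ⟨R v, by have := v.2; simp⟩

lemma continuous_sphMap (R : EE ≃ₗᵢ[ℝ] EE) : Continuous (sphMap R) :=
  (R.continuous.comp continuous_subtype_val).subtype_mk _

lemma map_sphMap (R : EE ≃ₗᵢ[ℝ] EE) :
    (uniformSphereMeasure d).map (sphMap R) = uniformSphereMeasure d := by
  rw [uniformSphereMeasure, Measure.map_smul]
  congr 1
  ext s hs
  rw [Measure.map_apply (continuous_sphMap R).measurable hs,
    Measure.toSphere_apply' _ ((continuous_sphMap R).measurable hs), Measure.toSphere_apply' _ hs]
  congr 1
  conv_rhs => rw [← (R.measurePreserving).measure_preimage_emb R.toHomeomorph.measurableEmbedding]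
  congr 1
  ext z
  simp only [Set.mem_smul, Set.mem_preimage, Set.mem_image]
  constructor
  · rintro ⟨c, hc, y, ⟨w, hw, rfl⟩, rfl⟩
    exact ⟨c, hc, _, ⟨sphMap R w, hw, rfl⟩, by simp [sphMap]⟩
  · rintro ⟨c, hc, y, ⟨w, hw, rfl⟩, h⟩
    refine ⟨c, hc, R.symm w, ⟨⟨R.symm w, by have := w.2; simp⟩, ?_, rfl⟩, ?_⟩
    · simpa [sphMap] using hw
    · apply R.injective; simp [← h]

lemma invariance (φ : ℝ → ℝ) (hφ : Continuous φ) (e e' : SS) :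
    ∫ v, φ (inner ℝ (e : EE) (v : EE)) ∂(uniformSphereMeasure d) =
    ∫ v, φ (inner ℝ (e' : EE) (v : EE)) ∂(uniformSphereMeasure d) := by
  obtain ⟨R, hR⟩ : ∃ R : EE ≃ₗᵢ[ℝ] EE, R e = e' :=
    ⟨_, Submodule.reflection_sub (by simp)⟩
  conv_rhs => rw [← map_sphMap R]
  rw [integral_map (continuous_sphMap R).aemeasurable]
  · congr 1; ext v
    simp only [sphMap]
    rw [← hR, R.inner_map_map]
  · exact Continuous.aestronglyMeasurable (by fun_prop)

lemma abs_inner_sph (u v : SS) : |inner ℝ (u : EE) (v : EE)| ≤ 1 := by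
  have := abs_real_inner_le_norm (u : EE) (v : EE)
  simpa using this

lemma integrable_sph (f : SS → ℝ) (hf : Continuous f) :
    Integrable f (uniformSphereMeasure d) := by
  exact hf.integrable_of_hasCompactSupport (HasCompactSupport.of_compactSpace f)

lemma inner_pow_expand (k : ℕ) (u v : EE) :
    inner ℝ u v ^ k = ∑ p : Fin k → Fin (d + 1), (∏ i, u (p i)) * ∏ i, v (p i) := by
  rw [PiLp.inner_apply, Fintype.sum_pow]
  refine Finset.sum_congr rfl fun p _ => ?_
  rw [← Finset.prod_mul_distrib]
  exact Finset.prod_congr rfl fun i _ => by simp [mul_comm]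

lemma moment_ineq (N : ℕ) (hN : 0 < N) (x : Fin N → SS) (e : SS) (k : ℕ) :
    ∫ v, inner ℝ (e : EE) (v : EE) ^ k ∂(uniformSphereMeasure d) ≤
      (1 / (N : ℝ) ^ 2) * ∑ j, ∑ i, inner ℝ (x j : EE) (x i : EE) ^ k := by
  set B := ∫ v, inner ℝ (e : EE) (v : EE) ^ k ∂(uniformSphereMeasure d) with hB
  have hinv : ∀ u : SS, ∫ v, inner ℝ (u : EE) (v : EE) ^ k ∂(uniformSphereMeasure d) = B :=
    fun u => invariance (fun t => t ^ k) (by fun_prop) u e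
  let F : (Fin k → Fin (d + 1)) → SS → ℝ := fun p u => ∏ i, (u : EE) (p i)
  have hF : ∀ p, Integrable (F p) (uniformSphereMeasure d) := fun p =>
    integrable_sph _ (by simp only [F]; fun_prop)
  let m : (Fin k → Fin (d + 1)) → ℝ := fun p => ∫ v, F p v ∂(uniformSphereMeasure d)
  have hexp : ∀ u v : SS, inner ℝ (u : EE) (v : EE) ^ k = ∑ p, F p u * F p v :=
    fun u v => inner_pow_expand k _ _
  have h1 : ∀ u : SS, ∑ p, F p u * m p = B := by
    intro u
    rw [← hinv u]
    simp only [hexp, m]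
    rw [integral_finsetSum _ (fun p _ => (hF p).const_mul _)]
    simp only [integral_const_mul]
  have h2 : ∑ p, m p * m p = B := by
    have : ∫ u, ∑ p, F p u * m p ∂(uniformSphereMeasure d) = B := by
      simp only [h1]; simp
    rw [integral_finsetSum _ (fun p _ => (hF p).mul_const _)] at this
    simpa only [integral_mul_const] using this
  have hNr : (0 : ℝ) < N := by exact_mod_cast hN
  have h3 : 0 ≤ ∑ p, (∑ j, (F p (x j) - m p)) ^ 2 := Finset.sum_nonneg fun p _ => sq_nonneg _
  have h4 : ∑ p, (∑ j, (F p (x j) - m p)) ^ 2 =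
      ∑ j, ∑ i, inner ℝ (x j : EE) (x i : EE) ^ k - (N : ℝ) ^ 2 * B := by
    have : ∀ p, (∑ j, (F p (x j) - m p)) ^ 2 =
        ∑ j, ∑ i, (F p (x j) * F p (x i) - F p (x j) * m p - F p (x i) * m p + m p * m p) := by
      intro p
      rw [sq, Finset.sum_mul_sum]
      exact Finset.sum_congr rfl fun j _ => Finset.sum_congr rfl fun i _ => by ring
    simp only [this]
    rw [Finset.sum_comm]
    have h5 : ∀ j, ∑ p, ∑ i, (F p (x j) * F p (x i) - F p (x j) * m p - F p (x i) * m p + m p * m p)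
        = ∑ i, (inner ℝ (x j : EE) (x i : EE) ^ k - B) := by
      intro j
      rw [Finset.sum_comm]
      refine Finset.sum_congr rfl fun i _ => ?_
      rw [Finset.sum_add_distrib, Finset.sum_sub_distrib, Finset.sum_sub_distrib, h1, h1, h2, hexp]
      ring
    simp only [h5, Finset.sum_sub_distrib]
    simp; ring
  rw [h4] at h3
  rw [one_div, inv_mul_eq_div, le_div_iff₀ (by positivity)]
  linarith

lemma norm_sub_rpow (s : ℝ) (u v : SS) :
    ‖(u : EE) - v‖ ^ (2 * s - d) =
      (2 : ℝ) ^ (s - d / 2) * (1 - inner ℝ (u : EE) (v : EE)) ^ (s - d / 2) := by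
  have h := norm_sub_sq_real (u : EE) (v : EE)
  have hu : ‖(u : EE)‖ = 1 := by simp
  have hv : ‖(v : EE)‖ = 1 := by simp
  rw [hu, hv] at h
  have h1 := (abs_le.1 (abs_inner_sph u v)).2
  rw [← Real.mul_rpow (by norm_num) (by linarith),
    show 2 * (1 - inner ℝ (u : EE) (v : EE)) = ‖(u : EE) - v‖ ^ 2 by rw [h]; ring,
    ← Real.rpow_natCast, ← Real.rpow_mul (norm_nonneg _)]
  congr 1; push_cast; ring

end sph

/-- For `d/2 < s < d/2+1` and any `N`-point configuration `x_1,…,x_N ⊂ S^d`, the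
normalized discrete generalized-distance sum never exceeds its continuous average:
`(1/N²)∑_{j,i}|x_j − x_i|^{2s−d} ≤ V_{d−2s}(S^d) = ∫∫ |x−y|^{2s−d} dσ_d dσ_d`,
i.e. `V_{d−2s}(S^d) − (1/N²)∑_{j,i}|x_j−x_i|^{2s−d} ≥ 0`. -/
theorem continuous_energy_sub_discrete_energy_nonneg (d : ℕ) (hd : 1 ≤ d)
    (s : ℝ) (hs1 : (d : ℝ) / 2 < s) (hs2 : s < (d : ℝ) / 2 + 1)
    (N : ℕ) (hN : 0 < N)
    (x : Fin N → Metric.sphere (0 : EuclideanSpace ℝ (Fin (d + 1))) 1) :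
    0 ≤ (∫ u, ∫ v, ‖(u : EuclideanSpace ℝ (Fin (d + 1))) - v‖ ^ (2 * s - d)
          ∂(uniformSphereMeasure d) ∂(uniformSphereMeasure d))
        - (1 / (N : ℝ) ^ 2) *
            ∑ j, ∑ i, ‖(x j : EuclideanSpace ℝ (Fin (d + 1))) -
              (x i : EuclideanSpace ℝ (Fin (d + 1)))‖ ^ (2 * s - d) := by
  have h0 : 0 < s - d / 2 := by linarith
  have h1 : s - d / 2 < 1 := by linarith
  have hNr : (0 : ℝ) < N := by exact_mod_cast hN
  haveI : Nonempty (Fin N) := ⟨⟨0, hN⟩⟩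
  let e := x ⟨0, hN⟩
  set a := s - d / 2 with ha
  let μ : Measure (Fin N × Fin N) := ENNReal.ofReal (1 / (N : ℝ) ^ 2) • Measure.count
  have hμ : ∀ f : Fin N × Fin N → ℝ, ∫ p, f p ∂μ = (1 / (N : ℝ) ^ 2) * ∑ j, ∑ i, f (j, i) := by
    intro f
    simp only [μ]
    rw [integral_smul_measure, integral_count, ENNReal.toReal_ofReal (by positivity), smul_eq_mul,
      Fintype.sum_prod_type]
  haveI : IsProbabilityMeasure μ := by
    constructor
    simp only [μ, Measure.smul_apply, smul_eq_mul]
    rw [Measure.count_apply_finite _ Set.finite_univ]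
    simp only [Set.Finite.toFinset_univ, Finset.card_univ, Fintype.card_prod, Fintype.card_fin]
    rw [← ENNReal.ofReal_natCast, ← ENNReal.ofReal_mul (by positivity), ← ENNReal.ofReal_one]
    congr 1
    push_cast
    field_simp
  have key := moment_comparison μ (uniformSphereMeasure d)
    (fun p => inner ℝ (x p.1 : EuclideanSpace ℝ (Fin (d + 1))) (x p.2 : EuclideanSpace ℝ (Fin (d + 1))))
    (measurable_of_countable _) (fun p => abs_inner_sph _ _)
    (fun v => inner ℝ (e : EuclideanSpace ℝ (Fin (d + 1))) (v : EuclideanSpace ℝ (Fin (d + 1))))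
    (Continuous.measurable (by fun_prop)) (fun p => abs_inner_sph _ _)
    (fun k => by rw [hμ]; exact moment_ineq N hN x e k) a h0 h1
  rw [hμ] at key
  simp only [norm_sub_rpow, ← ha, integral_const_mul]
  have hinv := fun u => invariance (d := d) (fun t => (1 - t) ^ a)
    (by exact (continuous_const.sub continuous_id).rpow_const fun _ => Or.inr h0.le) u e
  simp only [hinv]
  simp only [integral_const, probReal_univ, one_smul, ← Finset.mul_sum]
  rw [mul_left_comm, ← mul_sub]
  exact mul_nonneg (by positivity) (by linarith)
end
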